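/- Open summation formula in profile form: let h ≥ 1, let δ=(δ_1,...,δ_h) be a profile, and let Z^1,...,Z^h be alphabets; set Z_-^δ = Σ_{i: δ_i=−1} Z^i and Z_+^δ = Σ_{i: δ_i=1} Z^i. For partitions λ^0,...,λ^h let s_i^δ denote s_{λ^i/λ^{i−1}} if δ_i=1 and s_{λ^{i−1}/λ^i} if δ_i=−1. Then for any fixed partitions λ^0 and λ^h, Σ_{λ^1,...,λ^{h−1}} ∏_{i=1}^h s_i^δ(Z^i) = ∏_{1≤i<j≤h, δ_i>δ_j} Ψ(Z^i,Z^j) · Σ_γ s_{λ^0/γ}(Z_-^δ) s_{λ^h/γ}(Z_+^δ), as an identity of formal power series. -/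

import Mathlib

open scoped BigOperators

/-- An integer partition: a weakly decreasing, finitely supported sequence of
nonnegative integers. -/
structure Ptn where
  toFun : ℕ →₀ ℕ
  antitone' : ∀ ⦃i j : ℕ⦄, i ≤ j → toFun j ≤ toFun i

namespace Ptn
/-- the `i`-th part (0-indexed) -/
def part (lam : Ptn) (i : ℕ) : ℕ := lam.toFun i
/-- the size `|λ|` -/
def size (lam : Ptn) : ℕ := lam.toFun.sum fun _ k => k
end Ptn

/-- `HStrip μ λ` means `μ ≺ λ`, i.e. `λ/μ` is a horizontal strip:
`λ_i ≥ μ_i ≥ λ_{i+1}` for all `i`. -/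
def HStrip (mu lam : Ptn) : Prop :=
  ∀ i : ℕ, mu.part i ≤ lam.part i ∧ lam.part (i + 1) ≤ mu.part i
/-- Chains of partitions `μ = c 0 ≺ c 1 ≺ ⋯` stabilizing at `λ`; these encode
semistandard Young tableaux of shape `λ/μ` with entries in `{0, 1, 2, …}`. -/
def IsSchurChain (mu lam : Ptn) (c : ℕ → Ptn) : Prop :=
  c 0 = mu ∧ (∀ i, HStrip (c i) (c (i + 1))) ∧ ∃ N, ∀ i, N ≤ i → c i = lam

/-- the monomial attached to a chain: the variable `X i` records the cells added
at step `i` of the chain -/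
noncomputable def chainWeight {R : Type*} [CommRing R] (X : ℕ → R) (c : ℕ → Ptn) : R :=
  ∏ᶠ i : ℕ, X i ^ ((c (i + 1)).size - (c i).size)

/-- the skew Schur function `s_{λ/μ}(X)` (which is `0` if `μ ⊄ λ`) -/
noncomputable def skewSchur {R : Type*} [CommRing R] [TopologicalSpace R]
    (X : ℕ → R) (lam mu : Ptn) : R :=
  ∑' c : {c : ℕ → Ptn // IsSchurChain mu lam c}, chainWeight X c.1

/-- `Ψ(X,Y) = ∏_{i,j} (1 - x_i y_j)⁻¹` -/
noncomputable def Psi {R : Type*} [CommRing R] [TopologicalSpace R] [Inv R] (X Y : ℕ → R) : R :=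
  ∏' p : ℕ × ℕ, (1 - X p.1 * Y p.2)⁻¹

/-- `Φ(X) = ∏_i (1 - x_i)⁻¹ ∏_{i<j} (1 - x_i x_j)⁻¹` -/
noncomputable def Phi {R : Type*} [CommRing R] [TopologicalSpace R] [Inv R] (X : ℕ → R) : R :=
  (∏' i : ℕ, (1 - X i)⁻¹) * ∏' p : {q : ℕ × ℕ // q.1 < q.2}, (1 - X p.1.1 * X p.1.2)⁻¹
/-- the coefficientwise (product) topology on multivariate formal power series -/
instance (σ : Type*) : TopologicalSpace (MvPowerSeries σ ℚ) :=
  inferInstanceAs (TopologicalSpace ((σ →₀ ℕ) → ℚ))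

/-- the ambient ring: formal power series in the independent variables
`z^{(i)}_n` (`i, n ∈ ℕ`) -/
abbrev RZ : Type := MvPowerSeries ((ℕ × ℕ) ⊕ Unit) ℚ

/-- the alphabet `Z^i = {z^{(i)}_0, z^{(i)}_1, …}` -/
noncomputable def Za (i n : ℕ) : RZ := MvPowerSeries.X (Sum.inl (i, n))

/-- `Z^δ_- = Σ_{i : δ_i = -1} Z^i`, the union of the alphabets `Z^i` with
`δ_i = -1` (the remaining entries being `0`) -/
noncomputable def Zminus (h : ℕ) (δ : ℕ → ℤ) : ℕ → RZ :=
  fun n => if δ (n % h + 1) = -1 then Za (n % h + 1) (n / h) else 0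

/-- `Z^δ_+ = Σ_{i : δ_i = 1} Z^i`, the union of the alphabets `Z^i` with
`δ_i = 1` (the remaining entries being `0`) -/
noncomputable def Zplus (h : ℕ) (δ : ℕ → ℤ) : ℕ → RZ :=
  fun n => if δ (n % h + 1) = 1 then Za (n % h + 1) (n / h) else 0

/-- `Z = Z^1 + ⋯ + Z^h`, the union of all the alphabets `Z^1, …, Z^h` -/
noncomputable def Zall (h : ℕ) : ℕ → RZ :=
  fun n => Za (n % h + 1) (n / h)

/-- `δ` is a `±1`-profile on the indices `1, …, h` -/
def IsProfile (h : ℕ) (δ : ℕ → ℤ) : Prop := ∀ i, 1 ≤ i → i ≤ h → δ i = 1 ∨ δ i = -1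

/-- Every family indexed by a (small) type is summable. -/
class AllSummable (S : Type*) [AddCommMonoid S] [TopologicalSpace S] : Prop where
  summable {ι : Type} (f : ι → S) : Summable f

/-- Square matrices with rows and columns indexed by a possibly infinite type. -/
def Kern (I S : Type*) : Type _ := I → I → S

namespace Kern

section Basic

variable {I S : Type*}

@[ext] theorem ext {A B : Kern I S} (h : ∀ a b, A a b = B a b) : A = B :=
  funext fun a => funext fun b => h a b

/-- The transposed matrix. -/
def tr (A : Kern I S) : Kern I S := fun a b => A b a

@[simp] theorem tr_apply (A : Kern I S) (a b : I) : A.tr a b = A b a := rfl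

variable [CommSemiring S]

noncomputable instance : One (Kern I S) := ⟨fun a b => by classical exact if a = b then 1 else 0⟩

instance : SMul S (Kern I S) := ⟨fun s A a b => s * A a b⟩

theorem one_apply_self (a : I) : (1 : Kern I S) a a = 1 := if_pos rfl

theorem one_apply_ne {a b : I} (h : a ≠ b) : (1 : Kern I S) a b = 0 := if_neg h

theorem smul_apply (s : S) (A : Kern I S) (a b : I) : (s • A) a b = s * A a b := rfl

@[simp] theorem tr_one : (1 : Kern I S).tr = 1 := by
  ext a b
  rcases eq_or_ne a b with rfl | h
  · rfl
  · rw [tr_apply, one_apply_ne h, one_apply_ne h.symm]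

theorem mul_smul' (s t : S) (A : Kern I S) : (s * t) • A = s • t • A := by
  ext a b
  simp only [smul_apply, mul_assoc]

theorem one_smul' (A : Kern I S) : (1 : S) • A = A := by
  ext a b
  simp only [smul_apply, one_mul]

variable [TopologicalSpace S]

noncomputable instance : Mul (Kern I S) := ⟨fun A B a b => ∑' c, A a c * B c b⟩

theorem mul_apply (A B : Kern I S) (a b : I) : (A * B) a b = ∑' c, A a c * B c b := rfl

theorem tr_mul (A B : Kern I S) : (A * B).tr = B.tr * A.tr := by
  ext a b
  simp only [mul_apply, tr_apply, mul_comm]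

/-- `A` and `B` commute up to the scalar factor `s`. -/
def QuasiCommute (s : S) (A B : Kern I S) : Prop := A * B = s • (B * A)

theorem QuasiCommute.tr {s : S} {A B : Kern I S} (h : QuasiCommute s A B) :
    QuasiCommute s B.tr A.tr := by
  unfold QuasiCommute at *
  rw [← tr_mul, h, ← tr_mul]
  rfl

end Basic

section Monoid

variable {I : Type} {S : Type*} [CommSemiring S] [TopologicalSpace S]
  [IsTopologicalSemiring S] [T3Space S] [AllSummable S]

noncomputable instance : Monoid (Kern I S) where
  mul_assoc A B C := by
    ext a b
    simp only [mul_apply, ← (AllSummable.summable _).tsum_mul_left,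
      ← (AllSummable.summable _).tsum_mul_right]
    rw [Summable.tsum_comm' (AllSummable.summable _) (fun _ => AllSummable.summable _)
      (fun _ => AllSummable.summable _)]
    simp only [mul_assoc]
  one_mul A := by
    ext a b
    rw [mul_apply, tsum_eq_single a, one_apply_self, one_mul]
    intro c hc
    rw [one_apply_ne hc.symm, zero_mul]
  mul_one A := by
    ext a b
    rw [mul_apply, tsum_eq_single b, one_apply_self, mul_one]
    intro c hc
    rw [one_apply_ne hc, mul_zero]

theorem smul_mul (s : S) (A B : Kern I S) : (s • A) * B = s • (A * B) := by
  ext a b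
  simp only [mul_apply, smul_apply, mul_assoc, (AllSummable.summable _).tsum_mul_left]

theorem mul_smul_comm' (s : S) (A B : Kern I S) : A * (s • B) = s • (A * B) := by
  ext a b
  simp only [mul_apply, smul_apply, mul_left_comm _ s, (AllSummable.summable _).tsum_mul_left]

namespace QuasiCommute

variable {s t : S} {A B C : Kern I S}

theorem one_left : QuasiCommute 1 1 A := by
  rw [QuasiCommute, one_mul, mul_one, one_smul']

theorem mul_left (h : QuasiCommute s A C) (h' : QuasiCommute t B C) :
    QuasiCommute (s * t) (A * B) C := by
  unfold QuasiCommute at *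
  rw [mul_assoc, h', mul_smul_comm', ← mul_assoc, h, smul_mul, mul_comm s, mul_smul', mul_assoc]

end QuasiCommute

/-- Splitting off the last step of a path with fixed end points. -/
def pathEquiv (h : ℕ) (a b : I) :
    {L : Fin (h + 2) → I // L 0 = a ∧ L (Fin.last (h + 1)) = b} ≃
      Σ c : I, {L : Fin (h + 1) → I // L 0 = a ∧ L (Fin.last h) = c} where
  toFun L := ⟨L.1 (Fin.last h).castSucc, fun i => L.1 i.castSucc, L.2.1, rfl⟩
  invFun L := ⟨Fin.snoc (α := fun _ => I) L.2.1 b, by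
    refine ⟨?_, Fin.snoc_last _ _⟩
    exact (Fin.snoc_castSucc (α := fun _ => I) b L.2.1 0).trans L.2.2.1⟩
  left_inv L := by
    obtain ⟨L, rfl, rfl⟩ := L
    apply Subtype.ext
    exact Fin.snoc_init_self (α := fun _ => I) L
  right_inv L := by
    obtain ⟨c, L, h1, rfl⟩ := L
    have key : ∀ (M : Fin (h + 1) → I) (c : I) (hM : M 0 = a ∧ M (Fin.last h) = c), M = L →
        (⟨c, M, hM⟩ : Σ c : I, {L : Fin (h + 1) → I // L 0 = a ∧ L (Fin.last h) = c}) =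
          ⟨L (Fin.last h), L, h1, rfl⟩ := by
      rintro M c ⟨h2, rfl⟩ rfl
      rfl
    exact key _ _ _ (funext fun i => Fin.snoc_castSucc (α := fun _ => I) b L i)

theorem tsum_path (A : ℕ → Kern I S) (h : ℕ) (a b : I) :
    ∑' L : {L : Fin (h + 1) → I // L 0 = a ∧ L (Fin.last h) = b},
      ∏ i : Fin h, A i (L.1 i.castSucc) (L.1 i.succ) = ((List.range h).map A).prod a b := by
  induction h generalizing b with
  | zero =>
    rcases eq_or_ne a b with rfl | hab
    · rw [tsum_eq_single ⟨fun _ => a, rfl, rfl⟩]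
      · simp [one_apply_self]
      · rintro ⟨L, h1, h2⟩ hL
        exact absurd (Subtype.ext (funext fun i => by rw [Fin.fin_one_eq_zero i]; exact h1)) hL
    · have : IsEmpty {L : Fin (0 + 1) → I // L 0 = a ∧ L (Fin.last 0) = b} :=
        ⟨fun L => hab (L.2.1.symm.trans L.2.2)⟩
      rw [tsum_empty]
      simp [one_apply_ne hab]
  | succ h ih =>
    rw [List.prod_range_succ, mul_apply, ← (pathEquiv h a b).symm.tsum_eq,
      Summable.tsum_sigma' (fun _ => AllSummable.summable _) (AllSummable.summable _)]
    refine tsum_congr fun c => ?_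
    rw [← ih, ← (AllSummable.summable _).tsum_mul_right]
    refine tsum_congr fun L => ?_
    obtain ⟨L, h1, rfl⟩ := L
    have hlast : Fin.snoc (α := fun _ => I) L b (Fin.last h).succ = b := Fin.snoc_last _ _
    rw [Fin.prod_univ_castSucc]
    simp [pathEquiv, ← Fin.castSucc_succ, -Fin.succ_last, hlast]

end Monoid

end Kern

namespace Ptn

theorem ext_part {lam mu : Ptn} (h : ∀ i, lam.part i = mu.part i) : lam = mu := by
  obtain ⟨f, hf⟩ := lam
  obtain ⟨g, hg⟩ := mu
  congr 1
  exact Finsupp.ext h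

theorem exists_part_eq_zero (lam : Ptn) : ∃ N, ∀ i, N ≤ i → lam.part i = 0 := by
  refine ⟨lam.toFun.support.sup id + 1, fun i hi => ?_⟩
  by_contra h
  have := Finset.le_sup (f := id) (Finsupp.mem_support_iff.2 h)
  simp only [id] at this
  omega

theorem size_eq_sum {lam : Ptn} {N : ℕ} (h : ∀ i, N ≤ i → lam.part i = 0) :
    lam.size = ∑ i ∈ Finset.range N, lam.part i := by
  refine Finsupp.sum_of_support_subset _ (fun i hi => ?_) _ (fun _ _ => rfl)
  by_contra hN
  exact Finsupp.mem_support_iff.1 hi (h i (by simpa using hN))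

/-- The partition with prescribed parts. -/
noncomputable def ofParts (f : ℕ → ℕ) (hf : ∀ i, f (i + 1) ≤ f i)
    (h0 : ∃ N, ∀ i, N ≤ i → f i = 0) :
    Ptn where
  toFun := Finsupp.ofSupportFinite f <| by
    obtain ⟨N, hN⟩ := h0
    refine (Finset.range N).finite_toSet.subset fun i hi => ?_
    by_contra hlt
    exact hi (hN i (by simpa using hlt))
  antitone' := antitone_nat_of_succ_le hf

@[simp] theorem part_ofParts (f : ℕ → ℕ) (hf : ∀ i, f (i + 1) ≤ f i)
    (h0 : ∃ N, ∀ i, N ≤ i → f i = 0) (i : ℕ) : (ofParts f hf h0).part i = f i := rfl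

theorem finite_setOf_part_le (lam : Ptn) : {mu : Ptn | ∀ i, mu.part i ≤ lam.part i}.Finite := by
  have hinj : Function.Injective Ptn.toFun := fun mu nu h =>
    ext_part fun i => DFunLike.congr_fun h i
  exact ((Set.finite_Iic lam.toFun).preimage hinj.injOn).subset fun mu hmu i => hmu i

end Ptn

namespace HStrip

variable {mu lam nu : Ptn}

theorem refl (mu : Ptn) : HStrip mu mu := fun i => ⟨le_rfl, mu.antitone' (Nat.le_succ i)⟩

theorem part_eq_zero (h : HStrip mu lam) {N : ℕ} (hN : ∀ i, N ≤ i → lam.part i = 0) (i : ℕ)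
    (hi : N ≤ i) : mu.part i = 0 :=
  Nat.eq_zero_of_le_zero ((h i).1.trans (hN i hi).le)

theorem size_le (h : HStrip mu lam) : mu.size ≤ lam.size := by
  obtain ⟨N, hN⟩ := lam.exists_part_eq_zero
  rw [Ptn.size_eq_sum hN, Ptn.size_eq_sum (h.part_eq_zero hN)]
  exact Finset.sum_le_sum fun i _ => (h i).1

theorem eq_of_size_le (h : HStrip mu lam) (hs : lam.size ≤ mu.size) : mu = lam := by
  obtain ⟨N, hN⟩ := lam.exists_part_eq_zero
  have hs' := le_antisymm h.size_le hs
  rw [Ptn.size_eq_sum hN, Ptn.size_eq_sum (h.part_eq_zero hN),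
    Finset.sum_eq_sum_iff_of_le fun i _ => (h i).1] at hs'
  refine Ptn.ext_part fun i => ?_
  by_cases hi : i < N
  · exact hs' i (Finset.mem_range.2 hi)
  · rw [hN i (not_lt.1 hi), h.part_eq_zero hN i (not_lt.1 hi)]

end HStrip

section Toggle

variable {mu nu lam : Ptn}

/-- The largest possible `i`-th part of a partition between `mu` and `lam`. -/
def upperPart (mu lam : Ptn) : ℕ → ℕ
  | 0 => lam.part 0
  | i + 1 => min (lam.part (i + 1)) (mu.part i)

theorem HStrip.mid_bounds (h1 : HStrip mu nu) (h2 : HStrip nu lam) (i : ℕ) :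
    max (mu.part i) (lam.part (i + 1)) ≤ nu.part i ∧ nu.part i ≤ upperPart mu lam i := by
  refine ⟨max_le (h1 i).1 (h2 i).2, ?_⟩
  cases i with
  | zero => exact (h2 0).1
  | succ i => exact le_min (h2 (i + 1)).1 (h1 i).2

theorem upperPart_succ_le (i : ℕ) :
    upperPart mu lam (i + 1) ≤ max (mu.part i) (lam.part (i + 1)) :=
  (min_le_right _ _).trans (le_max_left _ _)

/-- The Bender-Knuth reflection of `nu` between `mu` and `lam`. -/
noncomputable def midToggle (h1 : HStrip mu nu) (h2 : HStrip nu lam) : Ptn :=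
  Ptn.ofParts (fun i => max (mu.part i) (lam.part (i + 1)) + upperPart mu lam i - nu.part i)
    (fun i => by
      have a := h1.mid_bounds h2 i
      have b := h1.mid_bounds h2 (i + 1)
      have c := upperPart_succ_le (mu := mu) (lam := lam) i
      omega)
    (by
      obtain ⟨N, hN⟩ := lam.exists_part_eq_zero
      refine ⟨N + 1, fun i hi => ?_⟩
      obtain ⟨i, rfl⟩ : ∃ j, i = j + 1 := ⟨i - 1, by omega⟩
      have h3 := h2.part_eq_zero hN
      rw [hN _ (by omega), h1.part_eq_zero h3 _ (by omega)]
      simp [upperPart, hN _ (show N ≤ i + 1 by omega)])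

theorem midToggle_add (h1 : HStrip mu nu) (h2 : HStrip nu lam) (i : ℕ) :
    (midToggle h1 h2).part i + nu.part i =
      max (mu.part i) (lam.part (i + 1)) + upperPart mu lam i := by
  have := h1.mid_bounds h2 i
  rw [midToggle, Ptn.part_ofParts]
  omega

theorem hStrip_midToggle_left (h1 : HStrip mu nu) (h2 : HStrip nu lam) :
    HStrip mu (midToggle h1 h2) := fun i => by
  have a := h1.mid_bounds h2 i
  have b := h1.mid_bounds h2 (i + 1)
  have a' := midToggle_add h1 h2 i
  have b' := midToggle_add h1 h2 (i + 1)
  simp only [upperPart] at *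
  omega

theorem hStrip_midToggle_right (h1 : HStrip mu nu) (h2 : HStrip nu lam) :
    HStrip (midToggle h1 h2) lam := fun i => by
  have a := h1.mid_bounds h2 i
  have a' := midToggle_add h1 h2 i
  have : upperPart mu lam i ≤ lam.part i := by
    cases i with
    | zero => exact le_rfl
    | succ i => exact min_le_left _ _
  omega

theorem size_midToggle (h1 : HStrip mu nu) (h2 : HStrip nu lam) :
    (midToggle h1 h2).size + nu.size = mu.size + lam.size := by
  obtain ⟨N, hN⟩ := lam.exists_part_eq_zero
  have hnu := h2.part_eq_zero hN
  have hmu := h1.part_eq_zero hnu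
  have hN' : ∀ i, N + 1 ≤ i → lam.part i = 0 := fun i hi => hN i (by omega)
  rw [Ptn.size_eq_sum (fun i (hi : N + 1 ≤ i) =>
      (hStrip_midToggle_right h1 h2).part_eq_zero hN i (by omega)),
    Ptn.size_eq_sum (fun i (hi : N + 1 ≤ i) => hnu i (by omega)),
    Ptn.size_eq_sum hmu, Ptn.size_eq_sum hN', ← Finset.sum_add_distrib,
    Finset.sum_congr rfl fun i _ => midToggle_add h1 h2 i]
  have key : ∀ n, ∑ i ∈ Finset.range (n + 1),
      (max (mu.part i) (lam.part (i + 1)) + upperPart mu lam i) =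
      ∑ i ∈ Finset.range n, mu.part i + ∑ i ∈ Finset.range (n + 1), lam.part i +
        max (mu.part n) (lam.part (n + 1)) := by
    intro n
    induction n with
    | zero => simp [upperPart, add_comm]
    | succ n ih =>
      rw [Finset.sum_range_succ, ih, Finset.sum_range_succ (fun i => mu.part i) n,
        Finset.sum_range_succ (fun i => lam.part i) (n + 1)]
      simp only [upperPart]
      omega
  rw [key, hmu N le_rfl, hN' (N + 1) le_rfl]
  rfl

/-- The Bender-Knuth involution on the partitions between `mu` and `lam`. -/
noncomputable def midEquiv (mu lam : Ptn) :
    {nu : Ptn // HStrip mu nu ∧ HStrip nu lam} ≃ {nu : Ptn // HStrip mu nu ∧ HStrip nu lam} :=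
  Function.Involutive.toPerm
    (fun nu => ⟨midToggle nu.2.1 nu.2.2, hStrip_midToggle_left nu.2.1 nu.2.2,
      hStrip_midToggle_right nu.2.1 nu.2.2⟩)
    (fun nu => Subtype.ext <| Ptn.ext_part fun i => by
      have a := midToggle_add nu.2.1 nu.2.2 i
      have b := midToggle_add (hStrip_midToggle_left nu.2.1 nu.2.2)
        (hStrip_midToggle_right nu.2.1 nu.2.2) i
      dsimp only
      omega)

theorem size_midEquiv (nu : {nu : Ptn // HStrip mu nu ∧ HStrip nu lam}) :
    (midEquiv mu lam nu).1.size + nu.1.size = mu.size + lam.size :=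
  size_midToggle nu.2.1 nu.2.2

/-- The partition `kap` below `mu` and `nu` obtained by the local rule from `lam` above both. -/
noncomputable def toggleDown (h1 : HStrip mu lam) (h2 : HStrip nu lam) : Ptn :=
  Ptn.ofParts (fun i => min (mu.part i) (nu.part i) + max (mu.part (i + 1)) (nu.part (i + 1)) -
      lam.part (i + 1))
    (fun i => by
      have := h1 i
      have := h1 (i + 1)
      have := h1 (i + 1 + 1)
      have := h2 i
      have := h2 (i + 1)
      have := h2 (i + 1 + 1)
      omega)
    (by
      obtain ⟨N, hN⟩ := lam.exists_part_eq_zero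
      refine ⟨N, fun i hi => ?_⟩
      rw [h1.part_eq_zero hN i hi, h1.part_eq_zero hN (i + 1) (by omega),
        h2.part_eq_zero hN (i + 1) (by omega)]
      simp)

theorem toggleDown_add (h1 : HStrip mu lam) (h2 : HStrip nu lam) (i : ℕ) :
    (toggleDown h1 h2).part i + lam.part (i + 1) =
      min (mu.part i) (nu.part i) + max (mu.part (i + 1)) (nu.part (i + 1)) := by
  have := h1 i
  have := h2 i
  have := h1 (i + 1)
  have := h2 (i + 1)
  rw [toggleDown, Ptn.part_ofParts]
  omega

/-- The parts of `toggleUp`. -/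
def toggleUpPart (mu nu kap : Ptn) (k : ℕ) : ℕ → ℕ
  | 0 => max (mu.part 0) (nu.part 0) + k
  | i + 1 => min (mu.part i) (nu.part i) + max (mu.part (i + 1)) (nu.part (i + 1)) - kap.part i

/-- The inverse of `toggleDown`, with first row extended by `k`. -/
noncomputable def toggleUp {kap : Ptn} (k : ℕ) (h1 : HStrip kap mu) (h2 : HStrip kap nu) : Ptn :=
  Ptn.ofParts (toggleUpPart mu nu kap k)
    (fun i => by
      cases i with
      | zero =>
        have := h1 0
        have := h2 0
        simp only [toggleUpPart]
        omega
      | succ i =>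
        have := h1 i
        have := h2 i
        have := h1 (i + 1)
        have := h2 (i + 1)
        simp only [toggleUpPart]
        omega)
    (by
      obtain ⟨N, hN⟩ := mu.exists_part_eq_zero
      obtain ⟨N', hN'⟩ := nu.exists_part_eq_zero
      refine ⟨N + N' + 1, fun i hi => ?_⟩
      obtain ⟨i, rfl⟩ : ∃ j, i = j + 1 := ⟨i - 1, by omega⟩
      simp only [toggleUpPart]
      rw [hN i (by omega), hN (i + 1) (by omega), hN' (i + 1) (by omega)]
      simp)

theorem part_zero_toggleUp {kap : Ptn} (k : ℕ) (h1 : HStrip kap mu) (h2 : HStrip kap nu) :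
    (toggleUp k h1 h2).part 0 = max (mu.part 0) (nu.part 0) + k := rfl

theorem toggleUp_add {kap : Ptn} (k : ℕ) (h1 : HStrip kap mu) (h2 : HStrip kap nu) (i : ℕ) :
    kap.part i + (toggleUp k h1 h2).part (i + 1) =
      min (mu.part i) (nu.part i) + max (mu.part (i + 1)) (nu.part (i + 1)) := by
  have := h1 i
  have := h2 i
  rw [toggleUp, Ptn.part_ofParts]
  simp only [toggleUpPart]
  omega

/-- The local growth rule as a bijection. -/
noncomputable def toggleEquiv (mu nu : Ptn) :
    {lam : Ptn // HStrip mu lam ∧ HStrip nu lam} ≃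
      ℕ × {kap : Ptn // HStrip kap mu ∧ HStrip kap nu} where
  toFun lam := (lam.1.part 0 - max (mu.part 0) (nu.part 0),
    ⟨toggleDown lam.2.1 lam.2.2, by
      constructor <;>
      · intro i
        have := toggleDown_add lam.2.1 lam.2.2 i
        have := lam.2.1 i
        have := lam.2.2 i
        have := lam.2.1 (i + 1)
        have := lam.2.2 (i + 1)
        omega⟩)
  invFun p := ⟨toggleUp p.1 p.2.2.1 p.2.2.2, by
      constructor <;>
      · intro i
        have h := toggleUp_add p.1 p.2.2.1 p.2.2.2
        have a := h i
        have := p.2.2.1 i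
        have := p.2.2.2 i
        refine ⟨?_, by omega⟩
        cases i with
        | zero =>
          rw [part_zero_toggleUp]
          omega
        | succ i =>
          have := h i
          have := p.2.2.1 i
          have := p.2.2.2 i
          omega⟩
  left_inv lam := Subtype.ext <| Ptn.ext_part fun i => by
    dsimp only
    cases i with
    | zero =>
      rw [part_zero_toggleUp]
      have := lam.2.1 0
      have := lam.2.2 0
      omega
    | succ i =>
      have a := toggleDown_add lam.2.1 lam.2.2 i
      have := toggleUp_add (lam.1.part 0 - max (mu.part 0) (nu.part 0))
        (kap := toggleDown lam.2.1 lam.2.2) (mu := mu) (nu := nu)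
        (fun i => by
          have := toggleDown_add lam.2.1 lam.2.2 i
          have := lam.2.1 i
          have := lam.2.2 i
          have := lam.2.1 (i + 1)
          have := lam.2.2 (i + 1)
          omega)
        (fun i => by
          have := toggleDown_add lam.2.1 lam.2.2 i
          have := lam.2.1 i
          have := lam.2.2 i
          have := lam.2.1 (i + 1)
          have := lam.2.2 (i + 1)
          omega) i
      omega
  right_inv p := by
    obtain ⟨k, kap, h1, h2⟩ := p
    refine Prod.ext ?_ (Subtype.ext <| Ptn.ext_part fun i => ?_)
    · dsimp only
      rw [part_zero_toggleUp]
      omega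
    · dsimp only
      rw [toggleDown, Ptn.part_ofParts]
      have := toggleUp_add k h1 h2 i
      omega

theorem size_toggleEquiv (lam : {lam : Ptn // HStrip mu lam ∧ HStrip nu lam}) :
    lam.1.size + (toggleEquiv mu nu lam).2.1.size =
      (toggleEquiv mu nu lam).1 + mu.size + nu.size := by
  obtain ⟨lam, h1, h2⟩ := lam
  change lam.size + (toggleDown h1 h2).size =
    (lam.part 0 - max (mu.part 0) (nu.part 0)) + mu.size + nu.size
  obtain ⟨N, hN⟩ := lam.exists_part_eq_zero
  have hmu := h1.part_eq_zero hN
  have hnu := h2.part_eq_zero hN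
  have hkap : ∀ i, N ≤ i → (toggleDown h1 h2).part i = 0 := fun i hi => by
    have := toggleDown_add h1 h2 i
    rw [hN _ (by omega), hmu _ hi, hnu _ hi, hmu _ (by omega), hnu _ (by omega)] at this
    simpa using this
  have hN' : ∀ i, N + 1 ≤ i → lam.part i = 0 := fun i hi => hN i (by omega)
  rw [Ptn.size_eq_sum hN', Ptn.size_eq_sum hkap, Ptn.size_eq_sum hmu, Ptn.size_eq_sum hnu]
  have key : ∀ n, ∑ i ∈ Finset.range (n + 1), lam.part i +
      ∑ i ∈ Finset.range n, (toggleDown h1 h2).part i =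
      (lam.part 0 - max (mu.part 0) (nu.part 0)) + ∑ i ∈ Finset.range n, mu.part i +
        ∑ i ∈ Finset.range n, nu.part i + max (mu.part n) (nu.part n) := by
    intro n
    induction n with
    | zero =>
      have := (h1 0).1
      have := (h2 0).1
      simp
      omega
    | succ n ih =>
      have := toggleDown_add h1 h2 n
      rw [Finset.sum_range_succ _ (n + 1)]
      simp only [Finset.sum_range_succ _ n] at ih ⊢
      omega
  rw [key, hmu N le_rfl, hnu N le_rfl]
  rfl

end Toggle

section StepKern

variable {S : Type*} [CommSemiring S]

/-- The matrix of single variable skew Schur functions `s_{λ/μ}(x)`. -/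
noncomputable def stepKern (x : S) : Kern Ptn S := fun mu lam => by
  classical exact if HStrip mu lam then x ^ (lam.size - mu.size) else 0

theorem stepKern_of_hStrip {x : S} {mu lam : Ptn} (h : HStrip mu lam) :
    stepKern x mu lam = x ^ (lam.size - mu.size) := if_pos h

theorem stepKern_of_not_hStrip {x : S} {mu lam : Ptn} (h : ¬ HStrip mu lam) :
    stepKern x mu lam = 0 := if_neg h

theorem stepKern_zero : stepKern (0 : S) = 1 := by
  ext mu lam
  by_cases h : HStrip mu lam
  · rw [stepKern_of_hStrip h]
    rcases eq_or_ne mu lam with rfl | hne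
    · simp [Kern.one_apply_self]
    · have : ¬ lam.size ≤ mu.size := fun hs => hne (h.eq_of_size_le hs)
      rw [Kern.one_apply_ne hne, zero_pow (by omega)]
  · rw [stepKern_of_not_hStrip h, Kern.one_apply_ne]
    rintro rfl
    exact h (HStrip.refl mu)

variable [TopologicalSpace S]

/-- The geometric series. -/
noncomputable def geom (t : S) : S := ∑' k : ℕ, t ^ k

theorem stepKern_mul_stepKern (x y : S) : stepKern x * stepKern y = stepKern y * stepKern x := by
  have key : ∀ (x y : S) (mu lam : Ptn), (stepKern x * stepKern y) mu lam =
      ∑' nu : {nu : Ptn // HStrip mu nu ∧ HStrip nu lam},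
        x ^ (nu.1.size - mu.size) * y ^ (lam.size - nu.1.size) := by
    intro x y mu lam
    rw [Kern.mul_apply, ← tsum_subtype_eq_of_support_subset
      (s := {nu : Ptn | HStrip mu nu ∧ HStrip nu lam})]
    · exact tsum_congr fun nu => by
        rw [stepKern_of_hStrip nu.2.1, stepKern_of_hStrip nu.2.2]
    · intro nu hnu
      by_contra h
      rw [Set.mem_ofPred_eq, not_and_or] at h
      rcases h with h | h <;> simp [stepKern_of_not_hStrip h] at hnu
  ext mu lam
  rw [key, key, ← (midEquiv mu lam).tsum_eq]
  refine tsum_congr fun nu => ?_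
  have h1 := size_midEquiv nu
  have h2 := nu.2.1.size_le
  have h3 := nu.2.2.size_le
  rw [mul_comm, show (midEquiv mu lam nu).1.size - mu.size = lam.size - nu.1.size by omega,
    show lam.size - (midEquiv mu lam nu).1.size = nu.1.size - mu.size by omega]

variable [IsTopologicalSemiring S] [T3Space S] [AllSummable S]

theorem quasiCommute_stepKern (x y : S) :
    Kern.QuasiCommute (geom (x * y)) (stepKern x) (stepKern y).tr := by
  ext mu nu
  rw [Kern.smul_apply, Kern.mul_apply, Kern.mul_apply, ← tsum_subtype_eq_of_support_subset
      (s := {lam : Ptn | HStrip mu lam ∧ HStrip nu lam}), ← tsum_subtype_eq_of_support_subset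
      (s := {kap : Ptn | HStrip kap mu ∧ HStrip kap nu}), geom,
      Summable.tsum_mul_tsum (AllSummable.summable _) (AllSummable.summable _)
        (AllSummable.summable _)]
  · refine Eq.trans (tsum_congr fun lam => ?_) ((toggleEquiv mu nu).tsum_eq _)
    have h := size_toggleEquiv lam
    obtain ⟨h1, h2⟩ := (toggleEquiv mu nu lam).2.2
    have a1 := h1.size_le
    have a2 := h2.size_le
    have a3 := lam.2.1.size_le
    have a4 := lam.2.2.size_le
    rw [Kern.tr_apply, Kern.tr_apply, stepKern_of_hStrip lam.2.1, stepKern_of_hStrip lam.2.2,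
      stepKern_of_hStrip h1, stepKern_of_hStrip h2,
      show lam.1.size - mu.size =
        (toggleEquiv mu nu lam).1 + (nu.size - (toggleEquiv mu nu lam).2.1.size) by omega,
      show lam.1.size - nu.size =
        (toggleEquiv mu nu lam).1 + (mu.size - (toggleEquiv mu nu lam).2.1.size) by omega]
    ring
  all_goals
    intro kap hkap
    by_contra h
    rw [Set.mem_ofPred_eq, not_and_or] at h
    rcases h with h | h <;> simp [stepKern_of_not_hStrip h] at hkap

variable (S) in
/-- The monoid generated by the matrices `stepKern x`. -/
noncomputable def schurMonoid : Submonoid (Kern Ptn S) :=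
  Submonoid.closure (Set.range stepKern)

instance : IsMulCommutative (schurMonoid S) :=
  Submonoid.isMulCommutative_closure _ <| by
    rintro _ ⟨x, rfl⟩ _ ⟨y, rfl⟩
    exact stepKern_mul_stepKern x y

noncomputable instance : CommMonoid (schurMonoid S) :=
  { (inferInstance : Monoid (schurMonoid S)) with
    mul_comm := fun a b => mul_comm' a b }

/-- `stepKern x` as an element of the commutative monoid `schurMonoid S`. -/
noncomputable def step (x : S) : schurMonoid S :=
  ⟨stepKern x, Submonoid.subset_closure ⟨x, rfl⟩⟩

theorem step_zero : step (0 : S) = 1 := Subtype.ext stepKern_zero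

theorem coe_prod_range (f : ℕ → schurMonoid S) (N : ℕ) :
    ((∏ n ∈ Finset.range N, f n : schurMonoid S) : Kern Ptn S) =
      ((List.range N).map fun n => (f n : Kern Ptn S)).prod := by
  induction N with
  | zero => rfl
  | succ N ih => rw [Finset.prod_range_succ, List.prod_range_succ, ← ih]; rfl

theorem quasiCommute_prod {ι : Type*} (s : Finset ι) (c : ι → S) (f : ι → schurMonoid S)
    (B : Kern Ptn S) (h : ∀ i ∈ s, Kern.QuasiCommute (c i) (f i).1 B) :
    Kern.QuasiCommute (∏ i ∈ s, c i) (∏ i ∈ s, f i : schurMonoid S).1 B := by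
  classical
  induction s using Finset.induction_on with
  | empty => exact Kern.QuasiCommute.one_left
  | insert a s ha ih =>
    rw [Finset.prod_insert ha, Finset.prod_insert ha]
    exact (h a (Finset.mem_insert_self a s)).mul_left
      (ih fun i hi => h i (Finset.mem_insert_of_mem hi))

theorem quasiCommute_prod_step (X Y : ℕ → S) (N : ℕ) :
    Kern.QuasiCommute (∏ i ∈ Finset.range N, ∏ j ∈ Finset.range N, geom (X i * Y j))
      (∏ i ∈ Finset.range N, step (X i) : schurMonoid S).1
      (∏ j ∈ Finset.range N, step (Y j) : schurMonoid S).1.tr := by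
  refine quasiCommute_prod _ _ _ _ fun i _ => ?_
  exact (quasiCommute_prod _ (fun j => geom (X i * Y j)) (fun j => step (Y j)) (stepKern (X i)).tr
    fun j _ => by rw [mul_comm]; exact quasiCommute_stepKern (Y j) (X i)).tr

/-- Sorting a word in matrices of `schurMonoid S` and their transposes. -/
theorem prod_eq_smul_tr_mul (up : ℕ → Prop) [DecidablePred up] (P : ℕ → schurMonoid S)
    (ψ : ℕ → ℕ → S) (hψ : ∀ i j, Kern.QuasiCommute (ψ i j) (P i).1 (P j).1.tr) (h : ℕ) :
    ((List.range h).map fun i => if up i then (P i).1 else (P i).1.tr).prod =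
      (∏ j ∈ Finset.range h, ∏ i ∈ Finset.range j, if up i ∧ ¬ up j then ψ i j else 1) •
        ((∏ i ∈ Finset.range h, if up i then 1 else P i : schurMonoid S).1.tr *
          (∏ i ∈ Finset.range h, if up i then P i else 1 : schurMonoid S).1) := by
  induction h with
  | zero =>
    simp [Kern.one_smul']
  | succ h ih =>
    rw [List.prod_range_succ, ih, Finset.prod_range_succ, Finset.prod_range_succ,
      Finset.prod_range_succ]
    by_cases hh : up h
    · simp [hh, Kern.smul_mul, mul_assoc]
    · have key : Kern.QuasiCommute (∏ i ∈ Finset.range h, if up i then ψ i h else 1)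
          (∏ i ∈ Finset.range h, if up i then P i else 1 : schurMonoid S).1 (P h).1.tr := by
        refine quasiCommute_prod _ _ _ _ fun i _ => ?_
        split_ifs
        · exact hψ i h
        · exact Kern.QuasiCommute.one_left
      simp only [hh, if_false, not_false_eq_true, and_true, mul_one]
      rw [Kern.smul_mul, mul_assoc, key, Kern.mul_smul_comm', Kern.mul_smul', ← mul_assoc,
        mul_comm (∏ i ∈ Finset.range h, if up i then 1 else P i), Submonoid.coe_mul, Kern.tr_mul]

theorem prod_range_mul_mod_div {M : Type*} [CommMonoid M] (F : ℕ → ℕ → M) (h N : ℕ) :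
    ∏ k ∈ Finset.range (h * N), F (k % h) (k / h) =
      ∏ i ∈ Finset.range h, ∏ n ∈ Finset.range N, F i n := by
  induction N with
  | zero => simp
  | succ N ih =>
    rw [Nat.mul_succ, Finset.prod_range_add, ih]
    simp only [Finset.prod_range_succ, Finset.prod_mul_distrib]
    congr 1
    refine Finset.prod_congr rfl fun i hi => ?_
    have hi := Finset.mem_range.1 hi
    rw [Nat.mul_add_mod, Nat.mod_eq_of_lt hi, Nat.mul_add_div (by omega), Nat.div_eq_of_lt hi,
      add_zero]

end StepKern

section SkewSchurSum

variable {S : Type*} [CommSemiring S]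

/-- The weight of a chain of partitions, over a commutative semiring. -/
noncomputable def chainWt (X : ℕ → S) (c : ℕ → Ptn) : S :=
  ∏ᶠ i : ℕ, X i ^ ((c (i + 1)).size - (c i).size)

theorem chainWt_eq_prod (X : ℕ → S) {c : ℕ → Ptn} {N : ℕ} (h : ∀ i, N ≤ i → c (i + 1) = c i) :
    chainWt X c = ∏ i ∈ Finset.range N, X i ^ ((c (i + 1)).size - (c i).size) := by
  refine finprod_eq_prod_of_mulSupport_subset _ fun i hi => ?_
  by_contra hN
  rw [Finset.coe_range, Set.mem_Iio, not_lt] at hN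
  exact hi (by simp [h i hN])

theorem IsSchurChain.eq_of_chainWt_ne_zero {X : ℕ → S} {mu lam : Ptn} {c : ℕ → Ptn} {N : ℕ}
    (hc : IsSchurChain mu lam c) (hX : ∀ n, N ≤ n → X n = 0) (h : chainWt X c ≠ 0) :
    ∀ i, N ≤ i → c i = lam := by
  obtain ⟨M, hM⟩ := hc.2.2
  have hM' : ∀ i, M ≤ i → c (i + 1) = c i := fun i hi => by rw [hM i hi, hM _ (by omega)]
  have hstep : ∀ i, N ≤ i → c (i + 1) = c i := by
    intro i hi
    by_cases hMi : M ≤ i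
    · exact hM' i hMi
    · by_contra hne
      have hlt : ¬ (c (i + 1)).size ≤ (c i).size := fun hs =>
        hne ((hc.2.1 i).eq_of_size_le hs).symm
      refine h ?_
      rw [chainWt_eq_prod X hM']
      refine Finset.prod_eq_zero (i := i) (Finset.mem_range.2 (by omega)) ?_
      rw [hX i hi, zero_pow (by omega)]
  have hconst : ∀ k, c (N + k) = c N := by
    intro k
    induction k with
    | zero => rfl
    | succ k ih => rw [← ih]; exact hstep _ (Nat.le_add_right N k)
  intro i hi
  obtain ⟨k, rfl⟩ := Nat.exists_eq_add_of_le hi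
  rw [hconst, ← hconst M]
  exact hM _ (by omega)

theorem IsSchurChain.chainWt_eq_prod_stepKern {X : ℕ → S} {mu lam : Ptn} {c : ℕ → Ptn} {N : ℕ}
    (hc : IsSchurChain mu lam c) (h : ∀ i, N ≤ i → c i = lam) :
    chainWt X c = ∏ i : Fin N, stepKern (X i) (c i) (c (i + 1)) := by
  rw [chainWt_eq_prod X (N := N) fun i hi => by rw [h i hi, h _ (by omega)],
    ← Fin.prod_univ_eq_prod_range (fun i => X i ^ ((c (i + 1)).size - (c i).size))]
  exact Finset.prod_congr rfl fun i _ => (stepKern_of_hStrip (hc.2.1 i)).symm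

variable [TopologicalSpace S]

/-- The skew Schur function, over a commutative semiring. -/
noncomputable def skewSchurSum (X : ℕ → S) (lam mu : Ptn) : S :=
  ∑' c : {c : ℕ → Ptn // IsSchurChain mu lam c}, chainWt X c.1

/-- The chain obtained from a finite path of partitions. -/
def pathChain {N : ℕ} (L : Fin (N + 1) → Ptn) (n : ℕ) : Ptn :=
  L ⟨min n N, by omega⟩

theorem pathChain_coe {N : ℕ} (L : Fin (N + 1) → Ptn) (i : Fin (N + 1)) :
    pathChain L i = L i :=
  congrArg L (Fin.ext (min_eq_left (by have := i.2; omega)))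

theorem pathChain_of_le {N : ℕ} (L : Fin (N + 1) → Ptn) {n : ℕ} (h : N ≤ n) :
    pathChain L n = L (Fin.last N) :=
  congrArg L (Fin.ext (min_eq_right h))

theorem isSchurChain_pathChain {N : ℕ} {L : Fin (N + 1) → Ptn}
    (hL : ∀ i : Fin N, HStrip (L i.castSucc) (L i.succ)) :
    IsSchurChain (L 0) (L (Fin.last N)) (pathChain L) := by
  refine ⟨pathChain_coe L 0, fun i => ?_, N, fun i hi => pathChain_of_le L hi⟩
  by_cases hi : i < N
  · have h1 := pathChain_coe L (Fin.castSucc ⟨i, hi⟩)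
    have h2 := pathChain_coe L (Fin.succ ⟨i, hi⟩)
    rw [Fin.val_castSucc] at h1
    rw [Fin.val_succ] at h2
    rw [h1, h2]
    exact hL _
  · rw [pathChain_of_le L (by omega), pathChain_of_le L (by omega)]
    exact HStrip.refl _

variable [IsTopologicalSemiring S] [T3Space S] [AllSummable S]

theorem skewSchurSum_eq (X : ℕ → S) (N : ℕ) (hX : ∀ n, N ≤ n → X n = 0) (lam mu : Ptn) :
    skewSchurSum X lam mu = (∏ n ∈ Finset.range N, step (X n) : schurMonoid S).1 mu lam := by
  rw [coe_prod_range, show (fun n => (step (X n) : Kern Ptn S)) = fun n => stepKern (X n) from rfl,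
    ← Kern.tsum_path, skewSchurSum]
  set g := fun L : {L : Fin (N + 1) → Ptn // L 0 = mu ∧ L (Fin.last N) = lam} =>
    ∏ i : Fin N, stepKern (X i) (L.1 i.castSucc) (L.1 i.succ) with hg
  have hstrip : ∀ L, g L ≠ 0 → ∀ i : Fin N, HStrip (L.1 i.castSucc) (L.1 i.succ) := by
    intro L hL i
    by_contra h
    exact hL (Finset.prod_eq_zero (Finset.mem_univ i) (stepKern_of_not_hStrip h))
  have hchain : ∀ L, g L ≠ 0 → IsSchurChain mu lam (pathChain L.1) := by
    intro L hL
    have := isSchurChain_pathChain (hstrip L hL)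
    rwa [L.2.1, L.2.2] at this
  refine tsum_eq_tsum_of_ne_zero_bij (g := g) (fun L => ⟨pathChain L.1.1, hchain L.1 L.2⟩)
    (fun L L' hLL' => ?_) (fun c hc => ?_) (fun L => ?_)
  · refine Subtype.ext (Subtype.ext (funext fun i => ?_))
    rw [← pathChain_coe L.1.1, ← pathChain_coe L'.1.1]
    exact congrFun (congrArg Subtype.val hLL') i
  · have hN := c.2.eq_of_chainWt_ne_zero hX hc
    have hgc : chainWt X c.1 = g ⟨fun i => c.1 i, c.2.1, hN _ le_rfl⟩ :=
      c.2.chainWt_eq_prod_stepKern hN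
    refine ⟨⟨⟨fun i => c.1 i, c.2.1, hN _ le_rfl⟩, ?_⟩, Subtype.ext (funext fun n => ?_)⟩
    · rw [Function.mem_support, ← hgc]
      exact hc
    · change c.1 (min n N) = c.1 n
      rcases le_total n N with h | h
      · rw [min_eq_left h]
      · rw [min_eq_right h, hN n h, hN N le_rfl]
  · refine ((hchain L.1 L.2).chainWt_eq_prod_stepKern (N := N) fun i hi => ?_).trans
      (Finset.prod_congr rfl fun i _ => ?_)
    · rw [pathChain_of_le _ hi, L.1.2.2]
    · have h1 := pathChain_coe L.1.1 i.castSucc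
      have h2 := pathChain_coe L.1.1 i.succ
      rw [Fin.val_castSucc] at h1
      rw [Fin.val_succ] at h2
      rw [h1, h2]

/-- The summation formula for alphabets with finitely many nonzero letters. -/
theorem tsum_prod_skewSchurSum (h N : ℕ) (hh : 0 < h) (up : ℕ → Prop) [DecidablePred up]
    (Z : ℕ → ℕ → S)
    (hZ : ∀ i n, N ≤ n → Z i n = 0) (lam0 lamh : Ptn) :
    ∑' L : {L : Fin (h + 1) → Ptn // L 0 = lam0 ∧ L (Fin.last h) = lamh},
      ∏ i : Fin h,
        (if up i then skewSchurSum (Z i) (L.1 i.succ) (L.1 i.castSucc)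
          else skewSchurSum (Z i) (L.1 i.castSucc) (L.1 i.succ)) =
    (∏ j ∈ Finset.range h, ∏ i ∈ Finset.range j, if up i ∧ ¬ up j then
        ∏ m ∈ Finset.range N, ∏ n ∈ Finset.range N, geom (Z i m * Z j n) else 1) *
      ∑' γ : Ptn,
        skewSchurSum (fun n => if up (n % h) then 0 else Z (n % h) (n / h)) lam0 γ *
          skewSchurSum (fun n => if up (n % h) then Z (n % h) (n / h) else 0) lamh γ := by
  set P : ℕ → schurMonoid S := fun i => ∏ n ∈ Finset.range N, step (Z i n) with hP
  set A : ℕ → Kern Ptn S := fun i => if up i then (P i).1 else (P i).1.tr with hA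
  have hL : ∀ L : {L : Fin (h + 1) → Ptn // L 0 = lam0 ∧ L (Fin.last h) = lamh},
      ∏ i : Fin h, (if up i then skewSchurSum (Z i) (L.1 i.succ) (L.1 i.castSucc)
          else skewSchurSum (Z i) (L.1 i.castSucc) (L.1 i.succ)) =
      ∏ i : Fin h, A i (L.1 i.castSucc) (L.1 i.succ) := by
    intro L
    refine Finset.prod_congr rfl fun i _ => ?_
    rw [hA]
    dsimp only
    split_ifs
    · exact skewSchurSum_eq _ N (hZ i) _ _
    · exact skewSchurSum_eq _ N (hZ i) _ _
  have hdiv : ∀ n, h * N ≤ n → Z (n % h) (n / h) = 0 := fun n hn =>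
    hZ _ _ ((Nat.le_div_iff_mul_le hh).2 (by rwa [mul_comm]))
  have hψ : ∀ i j, Kern.QuasiCommute
      (∏ m ∈ Finset.range N, ∏ n ∈ Finset.range N, geom (Z i m * Z j n)) (P i).1 (P j).1.tr :=
    fun i j => quasiCommute_prod_step (Z i) (Z j) N
  have hup : (∏ n ∈ Finset.range (h * N), step (if up (n % h) then Z (n % h) (n / h) else 0)) =
      ∏ i ∈ Finset.range h, if up i then P i else 1 := by
    rw [prod_range_mul_mod_div (fun i n => step (if up i then Z i n else 0)) h N]
    refine Finset.prod_congr rfl fun i _ => ?_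
    split_ifs
    · rfl
    · simp [step_zero]
  have hdown : (∏ n ∈ Finset.range (h * N), step (if up (n % h) then 0 else Z (n % h) (n / h))) =
      ∏ i ∈ Finset.range h, if up i then 1 else P i := by
    rw [prod_range_mul_mod_div (fun i n => step (if up i then 0 else Z i n)) h N]
    refine Finset.prod_congr rfl fun i _ => ?_
    split_ifs
    · simp [step_zero]
    · rfl
  refine (tsum_congr hL).trans ((Kern.tsum_path A h lam0 lamh).trans ?_)
  rw [prod_eq_smul_tr_mul up P _ hψ, Kern.smul_apply,
    Kern.mul_apply]
  congr 1
  refine tsum_congr fun γ => ?_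
  rw [skewSchurSum_eq _ (h * N) (fun n hn => by simp [hdiv n hn]),
    skewSchurSum_eq _ (h * N) (fun n hn => by simp [hdiv n hn]), hup, hdown]
  rfl

end SkewSchurSum

section ENatPowerSeries

variable {σ : Type*}

instance : TopologicalSpace (MvPowerSeries σ ℕ∞) :=
  inferInstanceAs (TopologicalSpace ((σ →₀ ℕ) → ℕ∞))

instance : IsTopologicalSemiring (MvPowerSeries σ ℕ∞) :=
  MvPowerSeries.WithPiTopology.instIsTopologicalSemiring σ ℕ∞

instance : T3Space (MvPowerSeries σ ℕ∞) :=
  inferInstanceAs (T3Space ((σ →₀ ℕ) → ℕ∞))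

theorem ENat.summable' {ι : Type*} (f : ι → ℕ∞) : Summable f :=
  ⟨_, hasSum_of_isLUB _ isLUB_iSup⟩

instance : AllSummable (MvPowerSeries σ ℕ∞) :=
  ⟨fun _ => MvPowerSeries.WithPiTopology.summable_iff_summable_coeff.2 fun _ => ENat.summable' _⟩

theorem coeff_tsum {ι : Type} (f : ι → MvPowerSeries σ ℕ∞) (d : σ →₀ ℕ) :
    MvPowerSeries.coeff d (∑' i, f i) = ∑' i, MvPowerSeries.coeff d (f i) :=
  ((MvPowerSeries.WithPiTopology.hasSum_iff_hasSum_coeff.1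
    (AllSummable.summable f).hasSum) d).tsum_eq.symm

open scoped Classical in
/-- Forgetting all the monomials involving a variable outside `P`. -/
noncomputable def killHom (R : Type*) [CommSemiring R] (P : Set σ) :
    MvPowerSeries σ R →+* MvPowerSeries σ R where
  toFun f d := if (d.support : Set σ) ⊆ P then MvPowerSeries.coeff d f else 0
  map_zero' := by
    funext d
    exact ite_eq_right_iff.2 fun _ => rfl
  map_one' := by
    funext d
    change _ = MvPowerSeries.coeff d 1
    rw [MvPowerSeries.coeff_one]
    split_ifs with h1 h2 h2
    · rfl
    · rfl
    · simp [h2] at h1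
    · rfl
  map_add' f g := by
    funext d
    by_cases h : (d.support : Set σ) ⊆ P
    · exact (if_pos h).trans ((map_add (MvPowerSeries.coeff d) f g).trans
        (congrArg₂ (· + ·) (if_pos h).symm (if_pos h).symm))
    · exact (if_neg h).trans ((add_zero (0 : R)).symm.trans
        (congrArg₂ (· + ·) (if_neg h).symm (if_neg h).symm))
  map_mul' f g := by
    funext d
    refine Eq.trans ?_ (MvPowerSeries.coeff_mul d _ _).symm
    have hsupp : ∀ p ∈ Finset.HasAntidiagonal.antidiagonal d,
        ((d.support : Set σ) ⊆ P ↔ (p.1.support : Set σ) ⊆ P ∧ (p.2.support : Set σ) ⊆ P) := by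
      intro p hp
      rw [← Finset.HasAntidiagonal.mem_antidiagonal.1 hp, Finsupp.support_add_eq_union, Finset.coe_union,
        Set.union_subset_iff]
    split_ifs with h
    · rw [MvPowerSeries.coeff_mul]
      refine Finset.sum_congr rfl fun p hp => ?_
      have := (hsupp p hp).1 h
      exact congrArg₂ _ (if_pos this.1).symm (if_pos this.2).symm
    · refine (Finset.sum_eq_zero fun p hp => ?_).symm
      have := mt (hsupp p hp).2 h
      rw [not_and_or] at this
      rcases this with h | h
      · exact mul_eq_zero_of_left (if_neg h) _
      · exact mul_eq_zero_of_right _ (if_neg h)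

section Kill

variable {R : Type*} [CommSemiring R] {P : Set σ}

theorem coeff_killHom_of_subset {d : σ →₀ ℕ} (h : (d.support : Set σ) ⊆ P)
    (f : MvPowerSeries σ R) :
    MvPowerSeries.coeff d (killHom R P f) = MvPowerSeries.coeff d f := if_pos h

theorem coeff_killHom_of_not_subset {d : σ →₀ ℕ} (h : ¬ (d.support : Set σ) ⊆ P)
    (f : MvPowerSeries σ R) : MvPowerSeries.coeff d (killHom R P f) = 0 := if_neg h

theorem killHom_X_of_notMem {s : σ} (h : s ∉ P) :
    killHom R P (MvPowerSeries.X s) = 0 := by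
  classical
  ext d
  by_cases hd : (d.support : Set σ) ⊆ P
  · rw [coeff_killHom_of_subset hd, MvPowerSeries.coeff_X, if_neg, map_zero]
    rintro rfl
    exact h (hd (by simp))
  · rw [coeff_killHom_of_not_subset hd, map_zero]

theorem killHom_map {T : Type*} [CommSemiring T] (φ : R →+* T) (f : MvPowerSeries σ R) :
    killHom T P (MvPowerSeries.map φ f) = MvPowerSeries.map φ (killHom R P f) := by
  ext d
  by_cases hd : (d.support : Set σ) ⊆ P
  · rw [coeff_killHom_of_subset hd, MvPowerSeries.coeff_map, MvPowerSeries.coeff_map,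
      coeff_killHom_of_subset hd]
  · rw [coeff_killHom_of_not_subset hd, MvPowerSeries.coeff_map, coeff_killHom_of_not_subset hd,
      map_zero]

theorem continuous_killHom : Continuous (killHom ℕ∞ P) := by
  refine continuous_pi fun d => ?_
  by_cases hd : (d.support : Set σ) ⊆ P
  · exact (continuous_apply d).congr fun f => (coeff_killHom_of_subset hd f).symm
  · exact continuous_const.congr fun f => (coeff_killHom_of_not_subset hd f).symm

theorem killHom_tsum {ι : Type} (f : ι → MvPowerSeries σ ℕ∞) :
    killHom ℕ∞ P (∑' i, f i) = ∑' i, killHom ℕ∞ P (f i) :=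
  (AllSummable.summable f).map_tsum (killHom ℕ∞ P) continuous_killHom

theorem killHom_geom (t : MvPowerSeries σ ℕ∞) :
    killHom ℕ∞ P (geom t) = geom (killHom ℕ∞ P t) := by
  simp only [geom, killHom_tsum, map_pow]

theorem killHom_skewSchurSum (X : ℕ → MvPowerSeries σ ℕ∞) (lam mu : Ptn) :
    killHom ℕ∞ P (skewSchurSum X lam mu) =
      skewSchurSum (fun n => killHom ℕ∞ P (X n)) lam mu := by
  rw [skewSchurSum, killHom_tsum]
  refine tsum_congr fun c => ?_
  obtain ⟨N, hN⟩ := c.2.2.2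
  have h : ∀ i, N ≤ i → c.1 (i + 1) = c.1 i := fun i hi => by rw [hN i hi, hN _ (by omega)]
  rw [chainWt_eq_prod _ h, chainWt_eq_prod _ h, map_prod]
  simp only [map_pow]

end Kill

end ENatPowerSeries

section Lift

variable {σ : Type*}

instance : T2Space (MvPowerSeries σ ℚ) :=
  inferInstanceAs (T2Space ((σ →₀ ℕ) → ℚ))

/-- The two power series have the same coefficients, which are natural numbers. -/
def IsLift (q : MvPowerSeries σ ℚ) (e : MvPowerSeries σ ℕ∞) : Prop :=
  ∃ p : MvPowerSeries σ ℕ,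
    MvPowerSeries.map (Nat.castRingHom ℚ) p = q ∧ MvPowerSeries.map (Nat.castRingHom ℕ∞) p = e

namespace IsLift

variable {q q' : MvPowerSeries σ ℚ} {e e' : MvPowerSeries σ ℕ∞}

theorem zero : IsLift (0 : MvPowerSeries σ ℚ) 0 := ⟨0, map_zero _, map_zero _⟩

theorem one : IsLift (1 : MvPowerSeries σ ℚ) 1 := ⟨1, map_one _, map_one _⟩

theorem X (s : σ) : IsLift (MvPowerSeries.X s) (MvPowerSeries.X s) :=
  ⟨MvPowerSeries.X s, MvPowerSeries.map_X _ s, MvPowerSeries.map_X _ s⟩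

theorem mul (h : IsLift q e) (h' : IsLift q' e') : IsLift (q * q') (e * e') := by
  obtain ⟨p, rfl, rfl⟩ := h
  obtain ⟨p', rfl, rfl⟩ := h'
  exact ⟨p * p', map_mul _ _ _, map_mul _ _ _⟩

theorem prod {ι : Type*} (s : Finset ι) {f : ι → MvPowerSeries σ ℚ} {g : ι → MvPowerSeries σ ℕ∞}
    (h : ∀ i ∈ s, IsLift (f i) (g i)) : IsLift (∏ i ∈ s, f i) (∏ i ∈ s, g i) := by
  classical
  induction s using Finset.induction_on with
  | empty => exact one
  | insert i s hi ih =>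
    rw [Finset.prod_insert hi, Finset.prod_insert hi]
    exact (h i (Finset.mem_insert_self i s)).mul
      (ih fun j hj => h j (Finset.mem_insert_of_mem hj))

theorem pow (h : IsLift q e) (n : ℕ) : IsLift (q ^ n) (e ^ n) := by
  obtain ⟨p, rfl, rfl⟩ := h
  exact ⟨p ^ n, map_pow _ _ _, map_pow _ _ _⟩

theorem unique (h : IsLift q e) (h' : IsLift q' e) : q = q' := by
  obtain ⟨p, rfl, rfl⟩ := h
  obtain ⟨p', rfl, hp⟩ := h'
  congr 1
  ext d
  have := congrArg (MvPowerSeries.coeff d) hp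
  rw [MvPowerSeries.coeff_map, MvPowerSeries.coeff_map] at this
  exact (Nat.cast_injective (R := ℕ∞) this).symm

theorem coeff_ne_top (h : IsLift q e) (d : σ →₀ ℕ) : MvPowerSeries.coeff d e ≠ ⊤ := by
  obtain ⟨p, rfl, rfl⟩ := h
  exact ENat.natCast_ne_top _

end IsLift

theorem ENat.finite_support_of_tsum_ne_top {ι : Type*} {f : ι → ℕ∞} (h : ∑' i, f i ≠ ⊤) :
    f.support.Finite := by
  by_contra hinf
  obtain ⟨n, hn⟩ := ENat.ne_top_iff_exists.1 h
  obtain ⟨s, hs, hcard⟩ := Set.Infinite.exists_subset_card_eq hinf (n + 1)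
  have h1 : ∑ i ∈ s, (1 : ℕ∞) ≤ ∑ i ∈ s, f i := Finset.sum_le_sum fun i hi =>
    Order.one_le_iff_ne_zero.2 (hs hi)
  have h2 : ∑ i ∈ s, f i ≤ ∑' i, f i := (ENat.summable' f).sum_le_tsum s fun _ _ => zero_le
  have h3 := h1.trans h2
  rw [← hn, Finset.sum_const, hcard, nsmul_one] at h3
  have : n + 1 ≤ n := by exact_mod_cast h3
  omega

theorem ENat.tsum_ne_top {ι : Type*} {f : ι → ℕ∞} (h : f.support.Finite) (h' : ∀ i, f i ≠ ⊤) :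
    ∑' i, f i ≠ ⊤ := by
  rw [tsum_eq_sum (s := h.toFinset) fun i hi => by simpa using hi]
  exact (WithTop.sum_lt_top.2 fun i _ => lt_top_iff_ne_top.2 (h' i)).ne

theorem IsLift.tsum {ι : Type} {f : ι → MvPowerSeries σ ℚ} {g : ι → MvPowerSeries σ ℕ∞}
    (h : ∀ i, IsLift (f i) (g i)) (hfin : ∀ d, MvPowerSeries.coeff d (∑' i, g i) ≠ ⊤) :
    IsLift (∑' i, f i) (∑' i, g i) := by
  choose p hp hp' using h
  obtain rfl : (fun i => MvPowerSeries.map (Nat.castRingHom ℚ) (p i)) = f := funext hp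
  obtain rfl : (fun i => MvPowerSeries.map (Nat.castRingHom ℕ∞) (p i)) = g := funext hp'
  have hsupp : ∀ d, (fun i => MvPowerSeries.coeff d (p i)).support.Finite := by
    intro d
    have h := hfin d
    rw [coeff_tsum] at h
    refine (ENat.finite_support_of_tsum_ne_top h).subset fun i hi => ?_
    exact fun h0 => hi (Nat.cast_injective (R := ℕ∞) (h0.trans Nat.cast_zero.symm))
  let q : MvPowerSeries σ ℕ := fun d => ∑ i ∈ (hsupp d).toFinset, MvPowerSeries.coeff d (p i)
  have hq : ∀ {R : Type} [CommSemiring R] [TopologicalSpace R] (φ : ℕ →+* R) (d : σ →₀ ℕ),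
      HasSum (fun i => MvPowerSeries.coeff d (MvPowerSeries.map φ (p i)))
        (MvPowerSeries.coeff d (MvPowerSeries.map φ q)) := by
    intro R _ _ φ d
    have : MvPowerSeries.coeff d (MvPowerSeries.map φ q) =
        ∑ i ∈ (hsupp d).toFinset, MvPowerSeries.coeff d (MvPowerSeries.map φ (p i)) := by
      rw [MvPowerSeries.coeff_map]
      exact map_sum φ _ _
    rw [this]
    refine hasSum_sum_of_ne_finset_zero fun i hi => ?_
    rw [MvPowerSeries.coeff_map, show MvPowerSeries.coeff d (p i) = 0 by simpa using hi, map_zero]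
  have h1 : HasSum (fun i => MvPowerSeries.map (Nat.castRingHom ℚ) (p i))
      (MvPowerSeries.map (Nat.castRingHom ℚ) q) :=
    Pi.hasSum.2 (hq (Nat.castRingHom ℚ))
  have h2 : HasSum (fun i => MvPowerSeries.map (Nat.castRingHom ℕ∞) (p i))
      (MvPowerSeries.map (Nat.castRingHom ℕ∞) q) :=
    Pi.hasSum.2 (hq (Nat.castRingHom ℕ∞))
  exact ⟨q, h1.tsum_eq.symm, h2.tsum_eq.symm⟩

theorem IsLift.inv_one_sub {t : MvPowerSeries σ ℚ} {t' : MvPowerSeries σ ℕ∞} (h : IsLift t t')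
    (h0 : MvPowerSeries.constantCoeff t = 0) : IsLift (1 - t)⁻¹ (geom t') := by
  have key : IsLift (∑' k : ℕ, t ^ k) (geom t') := by
    refine IsLift.tsum (fun k => h.pow k) fun d => ?_
    rw [coeff_tsum]
    refine ENat.tsum_ne_top ((Set.finite_Iic d.degree).subset fun k hk => ?_)
      fun k => (h.pow k).coeff_ne_top d
    by_contra hlt
    rw [Set.mem_Iic, not_le] at hlt
    refine hk (MvPowerSeries.coeff_of_lt_order (lt_of_lt_of_le (Nat.cast_lt.2 hlt)
      (MvPowerSeries.le_order_pow_of_constantCoeff_eq_zero k ?_)))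
    obtain ⟨p, rfl, rfl⟩ := h
    rw [← MvPowerSeries.coeff_zero_eq_constantCoeff_apply, MvPowerSeries.coeff_map] at h0 ⊢
    rw [Nat.cast_injective (R := ℚ) (h0.trans Nat.cast_zero.symm), map_zero]
  have h1 : MvPowerSeries.constantCoeff (1 - t) ≠ 0 := by simp [h0]
  have h2 : (∑' k : ℕ, t ^ k) * (1 - t) = 1 :=
    MvPowerSeries.WithPiTopology.tsum_pow_mul_one_sub_of_constantCoeff_eq_zero h0
  rwa [(MvPowerSeries.eq_inv_iff_mul_eq_one h1).2 h2] at key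

theorem killHom_eq_one_of_map {P : Set σ} {p : MvPowerSeries σ ℕ}
    (h : killHom ℕ∞ P (MvPowerSeries.map (Nat.castRingHom ℕ∞) p) = 1) : killHom ℕ P p = 1 := by
  rw [killHom_map, ← map_one (MvPowerSeries.map (Nat.castRingHom ℕ∞))] at h
  ext d
  have := congrArg (MvPowerSeries.coeff d) h
  rw [MvPowerSeries.coeff_map, MvPowerSeries.coeff_map] at this
  exact Nat.cast_injective (R := ℕ∞) this

/-- Infinite products of lifts, provided that each finite set of variables occurs in finitely many
factors only. -/
theorem IsLift.tprod {ι : Type*} {f : ι → MvPowerSeries σ ℚ} {g : ι → MvPowerSeries σ ℕ∞}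
    (h : ∀ i, IsLift (f i) (g i))
    (hfin : ∀ P : Finset σ, {i | killHom ℕ∞ (P : Set σ) (g i) ≠ 1}.Finite) :
    Multipliable g ∧ IsLift (∏' i, f i) (∏' i, g i) := by
  classical
  choose p hp hp' using h
  obtain rfl : (fun i => MvPowerSeries.map (Nat.castRingHom ℚ) (p i)) = f := funext hp
  obtain rfl : (fun i => MvPowerSeries.map (Nat.castRingHom ℕ∞) (p i)) = g := funext hp'
  have hone : ∀ P : Finset σ, ∀ i ∉ (hfin P).toFinset, killHom ℕ (P : Set σ) (p i) = 1 := by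
    intro P i hi
    rw [Set.Finite.mem_toFinset, Set.mem_ofPred_eq, not_not] at hi
    exact killHom_eq_one_of_map hi
  have hcoeff : ∀ d : σ →₀ ℕ, ∀ s, (hfin d.support).toFinset ⊆ s →
      MvPowerSeries.coeff d (∏ i ∈ s, p i) =
        MvPowerSeries.coeff d (∏ i ∈ (hfin d.support).toFinset, p i) := by
    intro d s hs
    rw [← coeff_killHom_of_subset (P := (d.support : Set σ)) le_rfl,
      ← coeff_killHom_of_subset (P := (d.support : Set σ)) le_rfl (∏ i ∈ _, p i),
      map_prod (killHom ℕ _), map_prod (killHom ℕ _), Finset.prod_subset hs fun i _ hi => hone _ i hi]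
  let q : MvPowerSeries σ ℕ := fun d =>
    MvPowerSeries.coeff d (∏ i ∈ (hfin d.support).toFinset, p i)
  have hq : ∀ {R : Type} [CommSemiring R] [TopologicalSpace R] (φ : ℕ →+* R) (d : σ →₀ ℕ),
      Filter.Tendsto (fun s : Finset ι =>
        MvPowerSeries.coeff d (∏ i ∈ s, MvPowerSeries.map φ (p i))) Filter.atTop
        (nhds (MvPowerSeries.coeff d (MvPowerSeries.map φ q))) := by
    intro R _ _ φ d
    refine tendsto_const_nhds.congr' ?_
    filter_upwards [Filter.eventually_ge_atTop (hfin d.support).toFinset] with s hs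
    rw [← map_prod, MvPowerSeries.coeff_map, MvPowerSeries.coeff_map, hcoeff d s hs]
    rfl
  have h1 : HasProd (fun i => MvPowerSeries.map (Nat.castRingHom ℚ) (p i))
      (MvPowerSeries.map (Nat.castRingHom ℚ) q) := by
    rw [HasProd, SummationFilter.unconditional_filter]
    exact tendsto_pi_nhds.2 (hq (Nat.castRingHom ℚ))
  have h2 : HasProd (fun i => MvPowerSeries.map (Nat.castRingHom ℕ∞) (p i))
      (MvPowerSeries.map (Nat.castRingHom ℕ∞) q) := by
    rw [HasProd, SummationFilter.unconditional_filter]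
    exact tendsto_pi_nhds.2 (hq (Nat.castRingHom ℕ∞))
  exact ⟨h2.multipliable, q, h1.tprod_eq.symm, h2.tprod_eq.symm⟩

end Lift

section SkewSchurLift

theorem IsSchurChain.part_le {mu lam : Ptn} {c : ℕ → Ptn} (hc : IsSchurChain mu lam c) (i : ℕ) :
    mu.part i ≤ lam.part i := by
  obtain ⟨h0, hstep, N, hN⟩ := hc
  have := monotone_nat_of_le_succ (f := fun n => (c n).part i) (fun n => (hstep n i).1)
    (Nat.zero_le N)
  simpa only [h0, hN N le_rfl] using this

variable {σ : Type*}

theorem IsLift.tsum_of_finite {ι : Type} {f : ι → MvPowerSeries σ ℚ} {g : ι → MvPowerSeries σ ℕ∞}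
    (h : ∀ i, IsLift (f i) (g i)) (hfin : g.support.Finite) :
    IsLift (∑' i, f i) (∑' i, g i) := by
  refine IsLift.tsum h fun d => ?_
  rw [coeff_tsum]
  refine ENat.tsum_ne_top (hfin.subset fun i hi h0 => hi ?_) fun i => (h i).coeff_ne_top d
  simp [h0]

theorem IsLift.killHom {q : MvPowerSeries σ ℚ} {e : MvPowerSeries σ ℕ∞} (h : IsLift q e)
    (P : Set σ) : IsLift (killHom ℚ P q) (killHom ℕ∞ P e) := by
  obtain ⟨p, rfl, rfl⟩ := h
  exact ⟨_, (killHom_map _ p).symm, (killHom_map _ p).symm⟩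

theorem support_skewSchurSum_subset (X : ℕ → MvPowerSeries σ ℕ∞) (lam : Ptn) :
    (skewSchurSum X lam).support ⊆ {mu | ∀ i, mu.part i ≤ lam.part i} := by
  intro mu hmu
  by_contra hle
  have : IsEmpty {c : ℕ → Ptn // IsSchurChain mu lam c} := ⟨fun c => hle c.2.part_le⟩
  exact hmu tsum_empty

theorem exists_isLift_prod_step {X : ℕ → MvPowerSeries σ ℕ∞} (hX : ∀ n, ∃ q, IsLift q (X n))
    (N : ℕ) (mu lam : Ptn) :
    ∃ q, IsLift q ((∏ n ∈ Finset.range N, step (X n) : schurMonoid _).1 mu lam) := by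
  induction N generalizing lam with
  | zero =>
    rcases eq_or_ne mu lam with rfl | h
    · exact ⟨1, by simpa [Kern.one_apply_self] using IsLift.one⟩
    · exact ⟨0, by simpa [Kern.one_apply_ne h] using IsLift.zero⟩
  | succ N ih =>
    have hstep : ∀ nu, ∃ q, IsLift q (stepKern (X N) nu lam) := by
      intro nu
      by_cases h : HStrip nu lam
      · obtain ⟨q, hq⟩ := hX N
        exact ⟨_, by rw [stepKern_of_hStrip h]; exact hq.pow _⟩
      · exact ⟨0, by rw [stepKern_of_not_hStrip h]; exact IsLift.zero⟩
    choose q hq using ih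
    choose r hr using hstep
    refine ⟨∑' nu, q nu * r nu, ?_⟩
    rw [Finset.prod_range_succ, Submonoid.coe_mul, Kern.mul_apply]
    refine IsLift.tsum_of_finite (fun nu => (hq nu).mul (hr nu))
      ((Ptn.finite_setOf_part_le lam).subset fun nu hnu => ?_)
    by_contra h
    refine hnu (mul_eq_zero_of_right _ (stepKern_of_not_hStrip fun hs => h fun i => (hs i).1))

theorem IsLift.skewSchur {x : ℕ → MvPowerSeries σ ℚ} {X : ℕ → MvPowerSeries σ ℕ∞}
    (h : ∀ n, IsLift (x n) (X n))
    (hX : ∀ P : Finset σ, ∃ N, ∀ n, N ≤ n → _root_.killHom ℕ∞ (P : Set σ) (X n) = 0)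
    (lam mu : Ptn) : IsLift (skewSchur x lam mu) (skewSchurSum X lam mu) := by
  refine IsLift.tsum (fun c => ?_) fun d => ?_
  · obtain ⟨N, hN⟩ := c.2.2.2
    have hc : ∀ i, N ≤ i → c.1 (i + 1) = c.1 i := fun i hi => by rw [hN i hi, hN _ (by omega)]
    change IsLift (chainWt x c.1) _
    rw [chainWt_eq_prod _ hc, chainWt_eq_prod _ hc]
    exact IsLift.prod _ fun i _ => (h i).pow _
  · change MvPowerSeries.coeff d (skewSchurSum X lam mu) ≠ ⊤
    obtain ⟨N, hN⟩ := hX d.support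
    rw [← coeff_killHom_of_subset (P := (d.support : Set σ)) le_rfl, killHom_skewSchurSum,
      skewSchurSum_eq _ N hN]
    obtain ⟨q, hq⟩ := exists_isLift_prod_step
      (fun n => ⟨_, (h n).killHom (d.support : Set σ)⟩) N mu lam
    exact hq.coeff_ne_top d

end SkewSchurLift

section Alphabets

/-- The alphabet `Z^i`, over `ℕ∞`. -/
noncomputable def ZaTop (i n : ℕ) : MvPowerSeries ((ℕ × ℕ) ⊕ Unit) ℕ∞ :=
  MvPowerSeries.X (Sum.inl (i, n))

/-- The first `N` letters of each alphabet. -/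
def firstLetters (N : ℕ) : Set ((ℕ × ℕ) ⊕ Unit) := {s | ∀ i n, s = Sum.inl (i, n) → n < N}

theorem killHom_ZaTop_of_le {N i n : ℕ} (h : N ≤ n) :
    killHom ℕ∞ (firstLetters N) (ZaTop i n) = 0 :=
  killHom_X_of_notMem fun hs => absurd (hs i n rfl) (not_lt.2 h)

theorem exists_subset_firstLetters (P : Finset ((ℕ × ℕ) ⊕ Unit)) :
    ∃ N, (P : Set ((ℕ × ℕ) ⊕ Unit)) ⊆ firstLetters N := by
  refine ⟨P.sup (Sum.elim (fun p => p.2 + 1) fun _ => 0), ?_⟩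
  rintro s hs i n rfl
  exact Finset.le_sup (f := Sum.elim (fun p : ℕ × ℕ => p.2 + 1) fun _ : Unit => 0) hs

theorem exists_killHom_ZaTop_eq_zero (P : Finset ((ℕ × ℕ) ⊕ Unit)) :
    ∃ N, ∀ i n, N ≤ n → killHom ℕ∞ (P : Set _) (ZaTop i n) = 0 := by
  obtain ⟨N, hN⟩ := exists_subset_firstLetters P
  exact ⟨N, fun i n hn => killHom_X_of_notMem fun hs => absurd (hN hs i n rfl) (not_lt.2 hn)⟩

theorem isLift_Za (i n : ℕ) : IsLift (Za i n) (ZaTop i n) := IsLift.X _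

/-- The product `Ψ(Z^i, Z^j)`, over `ℕ∞`. -/
noncomputable def psiTop (i j : ℕ) : MvPowerSeries ((ℕ × ℕ) ⊕ Unit) ℕ∞ :=
  ∏' p : ℕ × ℕ, geom (ZaTop i p.1 * ZaTop j p.2)

theorem geom_zero {σ : Type*} : geom (0 : MvPowerSeries σ ℕ∞) = 1 := by
  rw [geom, tsum_eq_single 0 fun k hk => zero_pow hk, pow_zero]

theorem multipliable_geom_and_isLift_psiTop (i j : ℕ) :
    (Multipliable fun p : ℕ × ℕ => geom (ZaTop i p.1 * ZaTop j p.2)) ∧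
      IsLift (Psi (Za i) (Za j)) (psiTop i j) := by
  refine IsLift.tprod (fun p => ((isLift_Za i p.1).mul (isLift_Za j p.2)).inv_one_sub ?_)
    fun P => ?_
  · simp [Za]
  · obtain ⟨N, hN⟩ := exists_killHom_ZaTop_eq_zero P
    refine ((Set.finite_Iio N).prod (Set.finite_Iio N)).subset fun p hp => ?_
    rw [Set.mem_prod, Set.mem_Iio, Set.mem_Iio]
    by_contra h
    refine hp ?_
    rw [not_and_or, not_lt, not_lt] at h
    rw [killHom_geom, map_mul]
    rcases h with h | h
    · rw [hN _ _ h, zero_mul, geom_zero]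
    · rw [hN _ _ h, mul_zero, geom_zero]

theorem killHom_psiTop (N i j : ℕ) :
    killHom ℕ∞ (firstLetters N) (psiTop i j) = ∏ m ∈ Finset.range N, ∏ n ∈ Finset.range N,
      geom (killHom ℕ∞ (firstLetters N) (ZaTop i m) *
        killHom ℕ∞ (firstLetters N) (ZaTop j n)) := by
  rw [psiTop, (multipliable_geom_and_isLift_psiTop i j).1.map_tprod (killHom ℕ∞ (firstLetters N))
    continuous_killHom, ← Finset.prod_product',
    tprod_eq_prod (s := Finset.range N ×ˢ Finset.range N)]
  · simp only [killHom_geom, map_mul]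
  · intro p hp
    rw [Finset.mem_product, Finset.mem_range, Finset.mem_range, not_and_or, not_lt, not_lt] at hp
    rw [killHom_geom, map_mul]
    rcases hp with h | h
    · rw [killHom_ZaTop_of_le h, zero_mul, geom_zero]
    · rw [killHom_ZaTop_of_le h, mul_zero, geom_zero]

theorem tsum_prod_skewSchurSum_ZaTop (h : ℕ) (hh : 0 < h) (up : ℕ → Prop) [DecidablePred up]
    (lam0 lamh : Ptn) :
    ∑' L : {L : Fin (h + 1) → Ptn // L 0 = lam0 ∧ L (Fin.last h) = lamh},
      ∏ i : Fin h,
        (if up i then skewSchurSum (ZaTop (i + 1)) (L.1 i.succ) (L.1 i.castSucc)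
          else skewSchurSum (ZaTop (i + 1)) (L.1 i.castSucc) (L.1 i.succ)) =
    (∏ j ∈ Finset.range h, ∏ i ∈ Finset.range j, if up i ∧ ¬ up j then
        psiTop (i + 1) (j + 1) else 1) *
      ∑' γ : Ptn,
        skewSchurSum (fun n => if up (n % h) then 0 else ZaTop (n % h + 1) (n / h)) lam0 γ *
          skewSchurSum (fun n => if up (n % h) then ZaTop (n % h + 1) (n / h) else 0) lamh γ := by
  ext d : 1
  obtain ⟨N, hN⟩ := exists_subset_firstLetters d.support
  rw [← coeff_killHom_of_subset hN, ← coeff_killHom_of_subset hN (_ * _)]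
  have key := tsum_prod_skewSchurSum h N hh up
    (fun i n => killHom ℕ∞ (firstLetters N) (ZaTop (i + 1) n))
    (fun i n hn => killHom_ZaTop_of_le hn) lam0 lamh
  congr 1
  simp only [killHom_tsum, map_mul, map_prod, apply_ite (killHom ℕ∞ (firstLetters N)),
    killHom_skewSchurSum, killHom_psiTop, map_one, map_zero]
  exact key

end Alphabets

section Profile

theorem IsProfile.eq_neg_one_iff {h : ℕ} {δ : ℕ → ℤ} (hδ : IsProfile h δ) {i : ℕ} (hi : i < h) :
    δ (i + 1) = -1 ↔ ¬ δ (i + 1) = 1 := by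
  rcases hδ (i + 1) (by omega) (by omega) with h | h <;> rw [h] <;> decide

theorem IsProfile.prod_filter {M : Type*} [CommMonoid M] {h : ℕ} {δ : ℕ → ℤ} (hδ : IsProfile h δ)
    (F : ℕ → ℕ → M) :
    ∏ q ∈ Finset.univ.filter
        (fun q : Fin h × Fin h => q.1 < q.2 ∧ δ ((q.1 : ℕ) + 1) > δ ((q.2 : ℕ) + 1)),
      F q.1 q.2 =
    ∏ j ∈ Finset.range h, ∏ i ∈ Finset.range j,
      if δ (i + 1) = 1 ∧ ¬ δ (j + 1) = 1 then F i j else 1 := by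
  rw [Finset.prod_filter, Fintype.prod_prod_type_right,
    ← Fin.prod_univ_eq_prod_range (fun j => ∏ i ∈ Finset.range j,
    if δ (i + 1) = 1 ∧ ¬ δ (j + 1) = 1 then F i j else 1)]
  refine Finset.prod_congr rfl fun j _ => ?_
  have hsub : Finset.range (j : ℕ) ⊆ Finset.range h := Finset.range_subset_range.2 j.2.le
  refine (Fin.prod_univ_eq_prod_range
    (fun i => if i < j ∧ δ (i + 1) > δ (j + 1) then F i j else 1) h).trans ?_
  rw [← Finset.prod_subset hsub]
  · refine Finset.prod_congr rfl fun i hi => ?_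
    rw [Finset.mem_range] at hi
    refine if_congr ?_ rfl rfl
    rcases hδ (i + 1) (by omega) (by omega) with h1 | h1 <;>
      rcases hδ (j + 1) (by omega) (by omega) with h2 | h2 <;> simp [h1, h2, hi]
  · intro i _ hi
    rw [Finset.mem_range] at hi
    exact if_neg fun h => hi h.1

end Profile

/-- **Open summation formula in profile form** (Theorem 2.1, equation (2.1)):
for a profile `δ = (δ_1, …, δ_h)` and fixed partitions `λ^0`, `λ^h`,
`Σ_{λ^1,…,λ^{h-1}} ∏_{i=1}^h s_i^δ(Z^i)
  = ∏_{1≤i<j≤h, δ_i>δ_j} Ψ(Z^i,Z^j) · Σ_γ s_{λ^0/γ}(Z^δ_-) s_{λ^h/γ}(Z^δ_+)`,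
where `s_i^δ = s_{λ^i/λ^{i-1}}` if `δ_i = 1` and `s_{λ^{i-1}/λ^i}` if `δ_i = -1`. -/
theorem open_summation_formula_profile (h : ℕ) (hh : 1 ≤ h) (δ : ℕ → ℤ)
    (hδ : IsProfile h δ) (lam0 lamh : Ptn) :
    ∑' L : {L : Fin (h + 1) → Ptn // L 0 = lam0 ∧ L (Fin.last h) = lamh},
      ∏ i : Fin h,
        (if δ ((i : ℕ) + 1) = 1 then skewSchur (Za ((i : ℕ) + 1)) (L.1 i.succ) (L.1 i.castSucc)
          else skewSchur (Za ((i : ℕ) + 1)) (L.1 i.castSucc) (L.1 i.succ))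
    = (∏ q ∈ Finset.univ.filter
          (fun q : Fin h × Fin h => q.1 < q.2 ∧ δ ((q.1 : ℕ) + 1) > δ ((q.2 : ℕ) + 1)),
          Psi (Za ((q.1 : ℕ) + 1)) (Za ((q.2 : ℕ) + 1))) *
        ∑' γ : Ptn, skewSchur (Zminus h δ) lam0 γ * skewSchur (Zplus h δ) lamh γ := by
  classical
  have hmod : ∀ n, n % h < h := fun n => Nat.mod_lt n hh
  have hdiv : ∀ P : Finset ((ℕ × ℕ) ⊕ Unit), ∃ N, ∀ n, N ≤ n →
      killHom ℕ∞ (P : Set _) (ZaTop (n % h + 1) (n / h)) = 0 := by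
    intro P
    obtain ⟨N, hN⟩ := exists_killHom_ZaTop_eq_zero P
    exact ⟨h * N, fun n hn => hN _ _ ((Nat.le_div_iff_mul_le hh).2 (by rwa [mul_comm]))⟩
  have hZ : ∀ i lam mu, IsLift (skewSchur (Za i) lam mu) (skewSchurSum (ZaTop i) lam mu) :=
    fun i => IsLift.skewSchur (isLift_Za i) fun P =>
      (exists_killHom_ZaTop_eq_zero P).imp fun N hN => hN i
  have hminus : ∀ lam mu, IsLift (skewSchur (Zminus h δ) lam mu) (skewSchurSum
      (fun n => if δ (n % h + 1) = 1 then 0 else ZaTop (n % h + 1) (n / h)) lam mu) := by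
    refine IsLift.skewSchur (fun n => ?_) fun P => (hdiv P).imp fun N hN n hn => ?_
    · rw [Zminus, if_congr (hδ.eq_neg_one_iff (hmod n)) rfl rfl, ite_not]
      split_ifs
      · exact IsLift.zero
      · exact isLift_Za _ _
    · rw [apply_ite (killHom ℕ∞ _), hN n hn, map_zero, ite_self]
  have hplus : ∀ lam mu, IsLift (skewSchur (Zplus h δ) lam mu) (skewSchurSum
      (fun n => if δ (n % h + 1) = 1 then ZaTop (n % h + 1) (n / h) else 0) lam mu) := by
    refine IsLift.skewSchur (fun n => ?_) fun P => (hdiv P).imp fun N hN n hn => ?_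
    · rw [Zplus]
      split_ifs
      · exact isLift_Za _ _
      · exact IsLift.zero
    · rw [apply_ite (killHom ℕ∞ _), hN n hn, map_zero, ite_self]
  rw [hδ.prod_filter fun i j => Psi (Za (i + 1)) (Za (j + 1))]
  have hR := (IsLift.prod (Finset.range h) fun j _ => IsLift.prod (Finset.range j)
      (f := fun i => if δ (i + 1) = 1 ∧ ¬ δ (j + 1) = 1 then Psi (Za (i + 1)) (Za (j + 1)) else 1)
      (g := fun i => if δ (i + 1) = 1 ∧ ¬ δ (j + 1) = 1 then psiTop (i + 1) (j + 1) else 1)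
      fun i _ => by
        split_ifs
        · exact (multipliable_geom_and_isLift_psiTop _ _).2
        · exact IsLift.one).mul
    (IsLift.tsum_of_finite (fun γ => (hminus lam0 γ).mul (hplus lamh γ))
      ((Ptn.finite_setOf_part_le lam0).subset fun γ hγ =>
        support_skewSchurSum_subset _ lam0 (left_ne_zero_of_mul hγ)))
  have key := tsum_prod_skewSchurSum_ZaTop h hh (fun i => δ (i + 1) = 1) lam0 lamh
  rw [← key] at hR
  refine (IsLift.tsum (fun L => IsLift.prod _ fun i _ => ?_) hR.coeff_ne_top).unique hR
  split_ifs
  · exact hZ _ _ _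
  · exact hZ _ _ _
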